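/- arXiv:1210.1015 — 3 statements merged into one kernel-verified Lean document; each statement's English description precedes it below -/
import Mathlib

section
/- Let d ≥ 1 and k ≥ 2, and let Ω be a finite set with |Ω| > max(2d, d²) and |Ω| ≤ k + d. If H is a subgroup of S_Ω that acts transitively on Ω and is k-thick, then H = A_Ω or H = S_Ω. -/
open MulAction Pointwise

theorem aux_comm_three {Ω : Type*} [Fintype Ω] [DecidableEq Ω] (σ τ : Equiv.Perm Ω) (p : Ω)
    (hσ : σ p ≠ p) (hτ : τ p ≠ p) (h : ∀ x, x ≠ p → σ x = x ∨ τ x = x) :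
    (σ * τ * σ⁻¹ * τ⁻¹).IsThreeCycle := by
  have h1 : τ (σ p) = σ p := by
    rcases h (σ p) hσ with h | h
    · exact absurd (σ.injective h) hσ
    · exact h
  have h2 : σ (τ p) = τ p := by
    rcases h (τ p) hτ with h | h
    · exact h
    · exact absurd (τ.injective h) hτ
  have hne : τ p ≠ σ p := fun e => by
    rw [e] at h2
    exact hσ (σ.injective h2)
  suffices hs : σ * τ * σ⁻¹ * τ⁻¹ = Equiv.swap p (τ p) * Equiv.swap p (σ p) by
    rw [hs]
    exact Equiv.Perm.isThreeCycle_swap_mul_swap_same hτ.symm hσ.symm hne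
  suffices hs : σ * τ = Equiv.swap p (τ p) * Equiv.swap p (σ p) * (τ * σ) by
    rw [hs]; group
  ext x
  simp only [Equiv.Perm.mul_apply]
  by_cases hxp : x = p
  · subst hxp
    rw [h1, h2, Equiv.swap_apply_right, Equiv.swap_apply_left]
  · have hcase : σ x = x ∨ (σ x ≠ x ∧ τ x = x) := by
      rcases h x hxp with h | h
      · exact Or.inl h
      · by_cases h' : σ x = x
        · exact Or.inl h'
        · exact Or.inr ⟨h', h⟩
    rcases hcase with hx | ⟨hx, hx'⟩
    · rw [hx]
      by_cases e : τ x = p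
      · rw [e, Equiv.swap_apply_left, Equiv.swap_apply_of_ne_of_ne hσ hne.symm]
      · have : σ (τ x) = τ x := by
          by_cases ht : τ x = x
          · rw [ht, hx]
          · rcases h _ e with h | h
            · exact h
            · exact absurd (τ.injective h) ht
        rw [this, Equiv.swap_apply_of_ne_of_ne e, Equiv.swap_apply_of_ne_of_ne e]
        · exact fun e' => hxp (τ.injective e')
        · intro e'
          rw [← h1] at e'
          have := τ.injective e'
          rw [← hx] at this
          exact hxp (σ.injective this)
    · rw [hx']
      by_cases e : σ x = p
      · rw [e, Equiv.swap_apply_of_ne_of_ne hτ hne, Equiv.swap_apply_right]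
      · have ht : τ (σ x) = σ x := by
          rcases h _ e with h | h
          · exact absurd (σ.injective h) hx
          · exact h
        rw [ht, Equiv.swap_apply_of_ne_of_ne e, Equiv.swap_apply_of_ne_of_ne e]
        · intro e'
          rw [← h2] at e'
          have := σ.injective e'
          rw [← hx'] at this
          exact hxp (τ.injective this)
        · exact fun e' => hxp (σ.injective e')

theorem aux_disjoint {Ω : Type*} [Fintype Ω] [DecidableEq Ω] (H : Subgroup (Equiv.Perm Ω))
    (htrans : ∀ x y : Ω, ∃ γ ∈ H, γ x = y) (U : Finset Ω)
    (hU : U.card ^ 2 < Fintype.card Ω) : ∃ g ∈ H, ∀ u ∈ U, g u ∉ U := by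
  classical
  by_contra! hcon
  let c : Ω → Ω → ℕ := fun u v => (Finset.univ.filter fun g : H => (g : Equiv.Perm Ω) u = v).card
  have hc : ∀ u v w, c u v ≤ c u w := by
    intro u v w
    obtain ⟨t, ht, htv⟩ := htrans v w
    refine Finset.card_le_card_of_injOn (fun g => (⟨t, ht⟩ : H) * g) ?_ ?_
    · intro g hg
      simp at hg ⊢
      rw [hg, htv]
    · intro a _ b _ hab
      exact mul_left_cancel hab
  have hn : ∀ u v, Fintype.card Ω * c u v = Fintype.card H := by
    intro u v
    have h1 : Fintype.card H = ∑ w, c u w := by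
      rw [← Finset.card_univ]
      exact Finset.card_eq_sum_card_fiberwise (f := fun g : H => (g : Equiv.Perm Ω) u)
        (t := Finset.univ) (by simp)
    rw [h1, Finset.sum_congr rfl (fun w _ => le_antisymm (hc u w v) (hc u v w))]
    simp
  have hle : Fintype.card H ≤ ∑ q ∈ U ×ˢ U, c q.1 q.2 := by
    rw [← Finset.card_univ]
    refine le_trans (Finset.card_le_card (t := (U ×ˢ U).biUnion
      fun q => Finset.univ.filter fun g : H => (g : Equiv.Perm Ω) q.1 = q.2) ?_)
      Finset.card_biUnion_le
    intro g _
    obtain ⟨u, hu, hgu⟩ := hcon g g.2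
    exact Finset.mem_biUnion.2 ⟨(u, (g : Equiv.Perm Ω) u), Finset.mem_product.2 ⟨hu, hgu⟩, by simp⟩
  have h2 : Fintype.card Ω * Fintype.card H ≤ U.card ^ 2 * Fintype.card H := by
    refine (Nat.mul_le_mul_left _ hle).trans ?_
    rw [Finset.mul_sum, Finset.sum_congr rfl (fun q _ => hn q.1 q.2)]
    simp [Finset.card_product, pow_two]
  have h3 : 0 < Fintype.card H := Fintype.card_pos
  exact absurd (Nat.le_of_mul_le_mul_right h2 h3) (by omega)

theorem aux_prim {Ω : Type*} [Fintype Ω] [DecidableEq Ω] (d : ℕ) 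
    (hΩ : d ^ 2 < Fintype.card Ω)
    (H : Subgroup (Equiv.Perm Ω))
    (htrans : ∀ x y : Ω, ∃ γ ∈ H, γ x = y)
    (hf : ∀ (f : Ω → Ω) (T : Finset Ω), (∀ x, f x ∈ T) → T.card + d ≤ Fintype.card Ω →
      ∃ γ ∈ H, γ ≠ 1 ∧ ∀ x, f (γ x) = f x)
    (hs : ∀ U : Finset Ω, d < U.card → ∃ γ ∈ H, γ ≠ 1 ∧ ∀ x ∉ U, γ x = x) :
    IsPreprimitive H Ω := by
  classical
  have hpt : IsPretransitive H Ω := ⟨fun x y => by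
    obtain ⟨g, hg, h⟩ := htrans x y
    exact ⟨⟨g, hg⟩, h⟩⟩
  refine { isTrivialBlock_of_isBlock := ?_ }
  intro B hB
  by_contra hnt
  unfold IsTrivialBlock at hnt
  push Not at hnt
  obtain ⟨hnt, hnu⟩ := hnt
  have hne : B.Nonempty := hnt.nonempty
  have hcard := hB.ncard_block_mul_ncard_orbit_eq hne
  rw [Nat.card_eq_fintype_card] at hcard
  -- translates
  have key : ∀ (g g' : H) (x : Ω), x ∈ g • B → x ∈ g' • B → g • B = g' • B := by
    intro g g' x h1 h2
    exact hB.smul_eq_smul_of_nonempty ⟨x, h1, h2⟩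
  rcases lt_or_ge d (orbit H B).ncard with hm | hm
  · have hC : ∀ C : orbit H B, ∃ x, x ∈ (C : Set Ω) := by
      rintro ⟨C, g, rfl⟩
      exact hne.smul_set
    choose r hr using hC
    have hrep : ∀ C D : orbit H B, ∀ x, x ∈ (C : Set Ω) → x ∈ (D : Set Ω) → C = D := by
      rintro ⟨C, g, rfl⟩ ⟨D, g', rfl⟩ x h1 h2
      exact Subtype.ext (key g g' x h1 h2)
    have hinj : Function.Injective r := fun C D h => hrep C D (r C) (hr C) (h ▸ hr D)
    obtain ⟨γ, hγ, hγ1, hγU⟩ := hs (Finset.univ.image r) (by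
      rw [Finset.card_image_of_injective _ hinj, Finset.card_univ, ← Nat.card_eq_fintype_card]
      exact hm)
    apply hγ1
    ext x
    by_contra hx
    change γ x ≠ x at hx
    have hxU : x ∈ Finset.univ.image r := by
      by_contra h
      exact hx (hγU x h)
    have hgxU : γ x ∈ Finset.univ.image r := by
      by_contra h
      exact hx (γ.injective (hγU _ h))
    simp only [Finset.mem_image, Finset.mem_univ, true_and] at hxU hgxU
    obtain ⟨C, rfl⟩ := hxU
    obtain ⟨D, hD⟩ := hgxU
    have hCn : (C : Set Ω).Nontrivial := by
      obtain ⟨C, g, rfl⟩ := C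
      exact hnt.image (MulAction.injective g)
    obtain ⟨y, hy, hyr⟩ := hCn.exists_ne (r C)
    have hyU : γ y = y := by
      apply hγU
      simp only [Finset.mem_image, Finset.mem_univ, true_and]
      rintro ⟨E, rfl⟩
      exact hyr (congrArg r (hrep E C _ (hr E) hy))
    have hgC : ∃ E : orbit H B, ∀ z ∈ (C : Set Ω), γ z ∈ (E : Set Ω) := by
      obtain ⟨C, g, rfl⟩ := C
      refine ⟨⟨((⟨γ, hγ⟩ : H) * g) • B, mem_orbit _ _⟩, ?_⟩
      intro z hz
      change γ z ∈ ((⟨γ, hγ⟩ : H) * g) • B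
      rw [mul_smul]
      exact Set.smul_mem_smul_set (a := (⟨γ, hγ⟩ : H)) hz
    obtain ⟨E, hE⟩ := hgC
    have hEC : E = C := hrep E C y (hyU ▸ hE y hy) hy
    have h3 := hE _ (hr C)
    rw [← hD] at h3
    have hDE := hrep D E _ (hr D) h3
    rw [hDE, hEC] at hD
    exact hx hD.symm
  · have hb : d < B.ncard := by
      by_contra h
      push Not at h
      have := Nat.mul_le_mul h hm
      nlinarith
    obtain ⟨x0, hx0⟩ := hne
    obtain ⟨y0, hy0⟩ := (Set.ne_univ_iff_exists_notMem B).1 hnu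
    obtain ⟨g, hg, hgx⟩ := htrans x0 y0
    have hdis : ∀ x ∈ B, g x ∉ B := by
      intro x hx hgB
      have h1 : (⟨g, hg⟩ : H) • B = (1 : H) • B :=
        key _ _ (g x) (Set.smul_mem_smul_set (a := (⟨g, hg⟩ : H)) hx) (by simpa using hgB)
      have h2 : g x0 ∈ (⟨g, hg⟩ : H) • B := Set.smul_mem_smul_set (a := (⟨g, hg⟩ : H)) hx0
      rw [h1, one_smul, hgx] at h2
      exact hy0 h2
    let S : Finset Ω := (B.toFinset.erase x0).image g
    have hS : ∀ x, x ∈ S ↔ g⁻¹ x ∈ B ∧ g⁻¹ x ≠ x0 := by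
      intro x
      simp only [S, Finset.mem_image, Finset.mem_erase, Set.mem_toFinset]
      constructor
      · rintro ⟨z, ⟨h1, h2⟩, rfl⟩
        simpa using ⟨h2, h1⟩
      · rintro ⟨h1, h2⟩
        exact ⟨_, ⟨h2, h1⟩, by simp⟩
    have hScard : S.card = B.ncard - 1 := by
      rw [Finset.card_image_of_injective _ g.injective, Finset.card_erase_of_mem (by simpa using hx0),
        Set.ncard_eq_toFinset_card']
    let f : Ω → Ω := fun x => if x ∈ S then g⁻¹ x else x
    have hBS : ∀ x ∈ B, x ∉ S := by
      intro x hx h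
      have := hdis _ ((hS x).1 h).1
      simp at this
      exact this hx
    have hf1 : ∀ x ∈ S, f x = g⁻¹ x := fun x hx => if_pos hx
    have hf2 : ∀ x ∉ S, f x = x := fun x hx => if_neg hx
    obtain ⟨γ, hγ, hγ1, hγf⟩ := hf f Sᶜ (by
      intro x
      rw [Finset.mem_compl]
      by_cases h : x ∈ S
      · rw [hf1 x h]
        exact hBS _ ((hS x).1 h).1
      · rwa [hf2 x h]) (by
      have := Finset.card_add_card_compl S
      omega)
    have h0 : γ x0 = x0 := by
      have h := hγf x0
      rw [hf2 x0 (hBS x0 hx0)] at h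
      by_cases hh : γ x0 ∈ S
      · rw [hf1 _ hh] at h
        exact absurd h ((hS _).1 hh).2
      · rwa [hf2 _ hh] at h
    have hγB : ∀ x ∈ B, γ x ∈ B := by
      intro x hx
      have h1 : (⟨γ, hγ⟩ : H) • B = (1 : H) • B := by
        refine key _ _ x0 ?_ (by simpa using hx0)
        have := Set.smul_mem_smul_set (a := (⟨γ, hγ⟩ : H)) hx0
        rwa [show (⟨γ, hγ⟩ : H) • x0 = x0 from h0] at this
      have h2 : γ x ∈ (⟨γ, hγ⟩ : H) • B := Set.smul_mem_smul_set (a := (⟨γ, hγ⟩ : H)) hx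
      rwa [h1, one_smul] at h2
    have hfix : ∀ x ∈ B, γ x = x := by
      intro x hx
      have h := hγf x
      rwa [hf2 x (hBS x hx), hf2 _ (hBS _ (hγB x hx))] at h
    apply hγ1
    ext x
    change γ x = x
    by_cases hxB : x ∈ B
    · exact hfix x hxB
    have hgxB : γ x ∉ B := by
      intro h
      have := γ.injective (hfix _ h)
      rw [this] at h
      exact hxB h
    have h := hγf x
    by_cases h1 : x ∈ S <;> by_cases h2 : γ x ∈ S
    · rw [hf1 _ h1, hf1 _ h2] at h
      exact (g⁻¹).injective h
    · rw [hf1 _ h1, hf2 _ h2] at h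
      exact absurd (h ▸ ((hS x).1 h1).1) hgxB
    · rw [hf2 _ h1, hf1 _ h2] at h
      exact absurd (h ▸ ((hS _).1 h2).1) hxB
    · rwa [hf2 _ h1, hf2 _ h2] at h

/-- A transitive `k`-thick subgroup of `S_Ω` with `max(2d, d²) < |Ω| ≤ k + d` is `A_Ω` or `S_Ω`. -/
theorem stmt_12 {Ω : Type*} [Fintype Ω] [DecidableEq Ω] (d k : ℕ) (hd : 1 ≤ d) (hk : 2 ≤ k)
    (hΩ : max (2 * d) (d ^ 2) < Fintype.card Ω) (hΩk : Fintype.card Ω ≤ k + d)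
    (H : Subgroup (Equiv.Perm Ω))
    (htrans : ∀ x y : Ω, ∃ γ ∈ H, γ x = y)
    (hthick : ∀ a : Ω → Fin k, ∃ γ ∈ H, γ ≠ 1 ∧ ∀ i, a (γ i) = a i) :
    H = alternatingGroup Ω ∨ H = ⊤ := by
  classical
  obtain ⟨hn1, hn2⟩ := max_lt_iff.1 hΩ
  have hf : ∀ (f : Ω → Ω) (T : Finset Ω), (∀ x, f x ∈ T) → T.card + d ≤ Fintype.card Ω →
      ∃ γ ∈ H, γ ≠ 1 ∧ ∀ x, f (γ x) = f x := by
    intro f T hT hc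
    have hc' : T.card ≤ k := by omega
    obtain ⟨γ, h1, h2, h3⟩ := hthick (fun x => Fin.castLE hc' (T.equivFin ⟨f x, hT x⟩))
    refine ⟨γ, h1, h2, fun x => ?_⟩
    have := T.equivFin.injective (Fin.castLE_injective hc' (h3 x))
    simpa using this
  have hs : ∀ U : Finset Ω, d < U.card → ∃ γ ∈ H, γ ≠ 1 ∧ ∀ x ∉ U, γ x = x := by
    intro U hU
    obtain ⟨u, hu⟩ : U.Nonempty := Finset.card_pos.1 (by omega)
    obtain ⟨γ, h1, h2, h3⟩ := hf (fun x => if x ∈ U then u else x) (insert u Uᶜ) (by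
      intro x
      by_cases h : x ∈ U <;> simp [h]) (by
      have := Finset.card_insert_le u Uᶜ
      have := Finset.card_add_card_compl U
      omega)
    refine ⟨γ, h1, h2, fun x hx => ?_⟩
    have h := h3 x
    simp only [hx, if_false] at h
    split_ifs at h with h'
    · exact absurd (h ▸ hu) hx
    · exact h
  have hprim := aux_prim d hn2 H htrans hf hs
  -- a maximal set supporting no nontrivial element
  obtain ⟨U, hU⟩ := Set.Finite.exists_maximal
    (s := {U : Finset Ω | ∀ γ ∈ H, (∀ x ∉ U, γ x = x) → γ = 1}) (Set.toFinite _)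
    ⟨∅, fun γ _ h => Equiv.ext fun x => h x (by simp)⟩
  have hUbad : ∀ γ ∈ H, (∀ x ∉ U, γ x = x) → γ = 1 := hU.1
  have hUd : U.card ≤ d := by
    by_contra h
    obtain ⟨γ, h1, h2, h3⟩ := hs U (by omega)
    exact h2 (hUbad γ h1 h3)
  have hmove : ∀ p ∉ U, ∃ γ ∈ H, γ p ≠ p ∧ ∀ x, x ≠ p → x ∉ U → γ x = x := by
    intro p hp
    by_contra! hcon
    have : insert p U ∈ {U : Finset Ω | ∀ γ ∈ H, (∀ x ∉ U, γ x = x) → γ = 1} := by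
      intro γ hγ h
      have h' : ∀ x, x ≠ p → x ∉ U → γ x = x := fun x h1 h2 => h x (by simp [h1, h2])
      apply hUbad γ hγ
      intro x hx
      by_cases e : x = p
      · subst e
        by_contra hne
        obtain ⟨y, h1, h2, h3⟩ := hcon γ hγ hne
        exact h3 (h' y h1 h2)
      · exact h' x e hx
    exact hp (hU.2 this (Finset.subset_insert p U) (Finset.mem_insert_self p U))
  obtain ⟨g, hg, hgU⟩ := aux_disjoint H htrans U
    (lt_of_le_of_lt (Nat.pow_le_pow_left hUd 2) hn2)
  obtain ⟨p, hp⟩ : ∃ p, p ∉ U ∪ U.image g := by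
    by_contra! h
    have h1 : U ∪ U.image g = Finset.univ := Finset.eq_univ_of_forall h
    have h2 := Finset.card_union_le U (U.image g)
    have h3 := Finset.card_image_le (s := U) (f := g)
    rw [h1, Finset.card_univ] at h2
    omega
  rw [Finset.mem_union, not_or] at hp
  obtain ⟨σ, hσ, hσp, hσf⟩ := hmove p hp.1
  have hgp : g⁻¹ p ∉ U := fun h => hp.2 (Finset.mem_image.2 ⟨_, h, by simp⟩)
  obtain ⟨τ, hτ, hτp, hτf⟩ := hmove (g⁻¹ p) hgp
  have h3 := aux_comm_three σ (g * τ * g⁻¹) p hσp (by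
      intro h
      apply hτp
      apply g.injective
      simpa using h) (by
      intro x hx
      by_cases hxU : x ∈ U
      · right
        have : τ (g⁻¹ x) = g⁻¹ x := by
          apply hτf
          · exact fun e => hx ((g⁻¹).injective e)
          · intro h
            have := hgU _ h
            simp at this
            exact this hxU
        simp only [Equiv.Perm.mul_apply]
        rw [this]
        simp
      · exact Or.inl (hσf x hx hxU))
  have hτ' : g * τ * g⁻¹ ∈ H := H.mul_mem (H.mul_mem hg hτ) (H.inv_mem hg)
  have hle := Equiv.Perm.alternatingGroup_le_of_isPreprimitive_of_isThreeCycle_mem hprim h3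
    (H.mul_mem (H.mul_mem (H.mul_mem hσ hτ') (H.inv_mem hσ)) (H.inv_mem hτ'))
  have : Nontrivial Ω := Fintype.one_lt_card_iff_nontrivial.1 (by omega)
  have hidx : H.index ∣ 2 := by
    have := Subgroup.index_dvd_of_le hle
    rwa [alternatingGroup.index_eq_two] at this
  rcases (Nat.dvd_prime Nat.prime_two).1 hidx with h | h
  · exact Or.inr (Subgroup.index_eq_one.1 h)
  · exact Or.inl (Equiv.Perm.eq_alternatingGroup_of_index_eq_two h)
end

section
/- Let d ≥ 1, n > d² + d, and k = n − d. Suppose G ≤ S_n is not Galois closed over k and the Galois closure H of G over k does not act transitively on {1,…,n}. Then H has an orbit B on {1,…,n} whose complement {1,…,n} ∖ B has fewer than d elements. -/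
/-- `σ ⊢ f`: the permutation `σ` leaves the function `f : ({1,…,k}^Ω) → {1,…,k}` invariant. -/
def InvariantUnder {Ω : Type*} (k : ℕ) (σ : Equiv.Perm Ω) (f : (Ω → Fin k) → Fin k) : Prop :=
  ∀ x : Ω → Fin k, f x = f (fun i => x (σ i))

/-- The Galois closure over `k` of a subgroup `G` of the symmetric group on `Ω`. -/
def galoisClosure {Ω : Type*} (k : ℕ) (G : Subgroup (Equiv.Perm Ω)) : Set (Equiv.Perm Ω) :=
  {σ | ∀ f : (Ω → Fin k) → Fin k, (∀ π ∈ G, InvariantUnder k π f) → InvariantUnder k σ f}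

/-- `G` is Galois closed over `k`. -/
def IsGaloisClosed {Ω : Type*} (k : ℕ) (G : Subgroup (Equiv.Perm Ω)) : Prop :=
  galoisClosure k G = (G : Set (Equiv.Perm Ω))

theorem closure_key {Ω : Type*} (k : ℕ) (hk : 2 ≤ k) (G : Subgroup (Equiv.Perm Ω))
    (σ : Equiv.Perm Ω) (hσ : σ ∈ galoisClosure k G) (a : Ω → Fin k) :
    ∃ π ∈ G, ∀ i, a (σ i) = a (π i) := by
  classical
  let P : (Ω → Fin k) → Prop := fun b => ∃ π ∈ G, ∀ i, b i = a (π i)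
  have h := hσ (fun b => if P b then ⟨1, by omega⟩ else ⟨0, by omega⟩) (by
    intro π hπ x
    have : P x ↔ P (fun i => x (π i)) := by
      constructor
      · rintro ⟨τ, hτ, h⟩
        exact ⟨τ * π, G.mul_mem hτ hπ, fun i => by simp [h]⟩
      · rintro ⟨τ, hτ, h⟩
        refine ⟨τ * π⁻¹, G.mul_mem hτ (G.inv_mem hπ), fun i => ?_⟩
        have := h (π⁻¹ i)
        simpa using this
    simp only [this]) a
  have h1 : P a := ⟨1, G.one_mem, fun i => rfl⟩
  by_contra hc
  have h2 : ¬ P (fun i => a (σ i)) := hc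
  simp [h1, h2] at h

/-- If `n > d² + d`, `k = n - d`, `G` is not Galois closed over `k` and its Galois closure
does not act transitively on `{1,…,n}`, then the closure has an orbit whose complement has
fewer than `d` elements. -/
theorem stmt_13 (d n k : ℕ) (hd : 1 ≤ d) (hn : d ^ 2 + d < n) (hk : k = n - d)
    (G : Subgroup (Equiv.Perm (Fin n))) (hG : ¬ IsGaloisClosed k G)
    (htrans : ¬ ∀ x y : Fin n, ∃ σ ∈ galoisClosure k G, σ x = y) :
    ∃ i : Fin n,
      Nat.card ↥({j : Fin n | ∃ σ ∈ galoisClosure k G, σ i = j}ᶜ) < d := by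
  classical
  have hk2 : 2 ≤ k := by
    have : 1 ≤ d ^ 2 := Nat.one_le_pow _ _ hd
    omega
  have hle : ∀ π ∈ G, π ∈ galoisClosure k G := fun π hπ f hf => hf π hπ
  by_contra! hcon
  apply hG
  apply Set.Subset.antisymm _ hle
  intro σ hσ
  have horb : ∀ x, σ x ∈ MulAction.orbit G x := by
    intro x
    obtain ⟨π, hπ, h⟩ := closure_key k hk2 G σ hσ
      (fun y => if y ∈ MulAction.orbit G x then ⟨1, by omega⟩ else ⟨0, by omega⟩)
    have h3 : π x ∈ MulAction.orbit G x := ⟨⟨π, hπ⟩, rfl⟩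
    have := h x
    by_contra hc
    simp [h3, hc] at this
  have hcard : ∀ x : Fin n, (MulAction.orbit G x).ncard ≤ k := by
    intro x
    have h1 := hcon x
    set S := {j : Fin n | ∃ σ ∈ galoisClosure k G, σ x = j} with hS
    have hsub : MulAction.orbit G x ⊆ S := by
      rintro _ ⟨⟨π, hπ⟩, rfl⟩
      exact ⟨π, hle π hπ, rfl⟩
    have h2 := Set.ncard_le_ncard hsub (Set.toFinite _)
    have h3 := Set.ncard_add_ncard_compl S
    rw [Nat.card_coe_set_eq] at h1
    simp at h3
    omega
  have hemb : ∀ q : MulAction.orbitRel.Quotient G (Fin n),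
      ∃ e : Fin n → Fin k, Set.InjOn e q.orbit := by
    intro q
    induction q using Quotient.inductionOn' with | _ x
    rw [MulAction.orbitRel.Quotient.orbit_mk]
    have hc : Nat.card (MulAction.orbit G x) ≤ Nat.card (Fin k) := by
      rw [Nat.card_coe_set_eq, Nat.card_fin]; exact hcard x
    have : NeZero k := ⟨by omega⟩
    obtain ⟨g⟩ := Function.Embedding.nonempty_of_card_le
      (α := MulAction.orbit G x) (β := Fin k)
      (by simpa only [Nat.card_eq_fintype_card] using hc)
    refine ⟨fun y => if hy : y ∈ MulAction.orbit G x then g ⟨y, hy⟩ else 0, ?_⟩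
    intro y hy z hz hyz
    simp only [hy, hz, dif_pos] at hyz
    simpa using g.injective hyz
  choose e he using hemb
  obtain ⟨π, hπ, h⟩ := closure_key k hk2 G σ hσ (fun y => e (Quotient.mk'' y) y)
  have : σ = π := by
    ext1 x
    have e1 : (Quotient.mk'' (σ x) : MulAction.orbitRel.Quotient G (Fin n)) = Quotient.mk'' x :=
      Quotient.sound' (horb x)
    have h3 : π x ∈ MulAction.orbit G x := ⟨⟨π, hπ⟩, rfl⟩
    have e2 : (Quotient.mk'' (π x) : MulAction.orbitRel.Quotient G (Fin n)) = Quotient.mk'' x :=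
      Quotient.sound' h3
    have h4 := h x
    simp only [e1, e2] at h4
    exact he _ (by rw [MulAction.orbitRel.Quotient.orbit_mk]; exact horb x)
      (by rw [MulAction.orbitRel.Quotient.orbit_mk]; exact h3) h4
  rw [this]; exact hπ
end

section
/- Let n ≥ 4 and k = n − 2. A subgroup G of S_n is NOT Galois closed over k if and only if G = A_n, or G = {σ ∈ A_n : σ(i) = i} for some i ∈ {1,…,n} (a point stabilizer in A_n, i.e., a natural copy of A_{n−1}), or n = 4 and G is the cyclic group generated by a 4-cycle. -/
open Equiv Equiv.Perm

/-- Combinatorial data: `H` is a right coset of `G` different from `G`. -/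
structure CosetData {n : ℕ} (G : Subgroup (Perm (Fin n))) (H : Set (Perm (Fin n))) : Prop where
  one : (1 : Perm (Fin n)) ∉ H
  gh : ∀ g ∈ G, ∀ h ∈ H, g * h ∈ H
  hh : ∀ h ∈ H, ∀ h' ∈ H, h * h'⁻¹ ∈ G
  pairs : ∀ a b c d : Fin n, a ≠ b → a ≠ c → a ≠ d → b ≠ c → b ≠ d → c ≠ d →
    swap a b ∈ H ∨ swap c d ∈ H ∨ swap a b * swap c d ∈ H

theorem mem_closure_of {Ω : Type*} {k : ℕ} {G : Subgroup (Perm Ω)} {σ : Perm Ω}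
    (h : ∀ x : Ω → Fin k, ∃ π ∈ G, ∀ i, x (σ i) = x (π i)) : σ ∈ galoisClosure k G := by
  intro f hf x
  obtain ⟨π, hπ, he⟩ := h x
  rw [hf π hπ x]
  congr 1
  funext i
  exact (he i).symm

theorem exists_of_mem_closure {Ω : Type*} {k : ℕ} (hk : 2 ≤ k) {G : Subgroup (Perm Ω)} {σ : Perm Ω}
    (h : σ ∈ galoisClosure k G) (x : Ω → Fin k) : ∃ π ∈ G, ∀ i, x (σ i) = x (π i) := by
  classical
  let f : (Ω → Fin k) → Fin k := fun y =>
    if ∃ π ∈ G, ∀ i, y i = x (π i) then ⟨0, by omega⟩ else ⟨1, by omega⟩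
  have hf : ∀ π ∈ G, InvariantUnder k π f := by
    intro π hπ y
    have : (∃ ρ ∈ G, ∀ i, y i = x (ρ i)) ↔ (∃ ρ ∈ G, ∀ i, y (π i) = x (ρ i)) := by
      constructor
      · rintro ⟨ρ, hρ, he⟩
        exact ⟨ρ * π, G.mul_mem hρ hπ, fun i => by simp [he]⟩
      · rintro ⟨ρ, hρ, he⟩
        exact ⟨ρ * π⁻¹, G.mul_mem hρ (G.inv_mem hπ), fun i => by simp [← he]⟩
    simp only [f, this]
  have h1 := h f hf x
  have h0 : ∃ π ∈ G, ∀ i, x i = x (π i) := ⟨1, G.one_mem, fun i => rfl⟩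
  by_contra hcon
  simp only [f] at h1
  rw [if_pos h0, if_neg hcon] at h1
  simp at h1

theorem not_closed_of {n : ℕ} {k : ℕ} {G : Subgroup (Perm (Fin n))} (σ : Perm (Fin n)) (hσ : σ ∉ G)
    (h : ∀ x : Fin n → Fin k, ∃ π ∈ G, ∀ i, x (σ i) = x (π i)) : ¬ IsGaloisClosed k G := by
  intro hc
  apply hσ
  have := mem_closure_of h
  rw [hc] at this
  exact this

theorem pair_stab {n : ℕ} {a b c d : Fin n} (h1 : a ≠ b) (h2 : a ≠ c) (h3 : a ≠ d) (h4 : b ≠ c)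
    (h5 : b ≠ d) (h6 : c ≠ d) : ∃ x : Fin n → Fin (n-2), ∀ τ : Perm (Fin n),
      (∀ i, x (τ i) = x i) → τ = 1 ∨ τ = swap a b ∨ τ = swap c d ∨ τ = swap a b * swap c d := by
  classical
  have hcard : Fintype.card {p : Fin n // p ∉ ({b, d} : Finset (Fin n))} = n - 2 := by
    rw [Fintype.card_subtype_compl, Fintype.card_coe, Finset.card_pair h5, Fintype.card_fin]
  let e := Fintype.equivFinOfCardEq hcard
  let r : Fin n → {p : Fin n // p ∉ ({b, d} : Finset (Fin n))} := fun p =>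
    if hb : p = b then ⟨a, by simp [h1, h3]⟩ else if hd : p = d then ⟨c, by simp [h4.symm, h6]⟩
    else ⟨p, by simp [hb, hd]⟩
  refine ⟨fun p => e (r p), fun τ hτ => ?_⟩
  have hr : ∀ i, (r (τ i)).1 = (r i).1 := fun i => by rw [e.injective (hτ i)]
  have hv : ∀ p, (r p).1 = if p = b then a else if p = d then c else p := by
    intro p
    simp only [r]
    split_ifs <;> rfl
  simp only [hv] at hr
  have hinj : ∀ i j, τ i = τ j → i = j := fun i j h => τ.injective h
  have ho : ∀ i, i ≠ a → i ≠ b → i ≠ c → i ≠ d → τ i = i := by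
    intro i _ _ _ _
    have := hr i
    grind
  have hA : (τ a = a ∧ τ b = b) ∨ (τ a = b ∧ τ b = a) := by
    have := hr a; have := hr b; have := hinj a b; grind
  have hC : (τ c = c ∧ τ d = d) ∨ (τ c = d ∧ τ d = c) := by
    have := hr c; have := hr d; have := hinj c d; grind
  rcases hA with ⟨ha, hb⟩ | ⟨ha, hb⟩ <;> rcases hC with ⟨hc, hd⟩ | ⟨hc, hd⟩
  · left; ext i; simp; grind
  · right; right; left; ext i; simp only [swap_apply_def]; grind
  · right; left; ext i; simp only [swap_apply_def]; grind
  · right; right; right; ext i; simp only [Perm.mul_apply, swap_apply_def]; grind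

theorem exists_data {n : ℕ} (hn : 4 ≤ n) {G : Subgroup (Perm (Fin n))}
    (h : ¬ IsGaloisClosed (n-2) G) : ∃ H, CosetData G H := by
  have : ∃ σ, σ ∈ galoisClosure (n-2) G ∧ σ ∉ G := by
    by_contra! hcon
    apply h
    apply Set.Subset.antisymm hcon
    intro σ hσ
    exact mem_closure_of fun x => ⟨σ, hσ, fun i => rfl⟩
  obtain ⟨σ, hσ, hG⟩ := this
  refine ⟨{τ | τ * σ ∈ G}, by simpa using hG, ?_, ?_, ?_⟩
  · intro g hg h hh
    simp only [Set.mem_ofPred_eq, mul_assoc] at *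
    exact G.mul_mem hg hh
  · intro h hh h' hh'
    have := G.mul_mem hh (G.inv_mem hh')
    simpa [mul_assoc] using this
  · intro a b c d h1 h2 h3 h4 h5 h6
    obtain ⟨x, hx⟩ := pair_stab h1 h2 h3 h4 h5 h6
    obtain ⟨π, hπ, he⟩ := exists_of_mem_closure (by omega) hσ x
    have hm : (π * σ⁻¹) * σ ∈ G := by simpa using hπ
    rcases hx (π * σ⁻¹) (fun i => by
      have := he (σ⁻¹ i)
      simpa using this.symm) with h | h | h | h <;> rw [h] at hm
    · exact absurd (by simpa using hm) hG
    · exact Or.inl hm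
    · exact Or.inr (Or.inl hm)
    · exact Or.inr (Or.inr hm)

namespace CosetData
variable {n : ℕ} {G : Subgroup (Perm (Fin n))} {H : Set (Perm (Fin n))}

theorem disj (D : CosetData G H) {g : Perm (Fin n)} (hg : g ∈ G) (hh : g ∈ H) : False := by
  have := D.gh _ (G.inv_mem hg) _ hh
  exact D.one (by simpa using this)

theorem trans (D : CosetData G H) {a b c : Fin n} (h : a ≠ c) (h1 : swap a b ∈ H)
    (h2 : swap b c ∈ H) : swap a c ∈ H := by
  have hab : a ≠ b := by rintro rfl; exact D.one (by rwa [swap_self] at h1)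
  have hbc : b ≠ c := by rintro rfl; exact D.one (by rwa [swap_self] at h2)
  have := D.gh _ (D.hh _ h1 _ h2) _ h1
  convert this using 1
  ext i
  simp only [Perm.mul_apply, swap_inv, swap_apply_def]
  grind

/-- four pairwise inequivalent points are impossible -/
theorem four (D : CosetData G H) {a b c d : Fin n} (h1 : a ≠ b) (h2 : a ≠ c) (h3 : a ≠ d)
    (h4 : b ≠ c) (h5 : b ≠ d) (h6 : c ≠ d) (e1 : swap a b ∉ H) (e2 : swap a c ∉ H)
    (e3 : swap a d ∉ H) (e4 : swap b c ∉ H) (e5 : swap b d ∉ H) (e6 : swap c d ∉ H) : False := by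
  have p1 : swap a b * swap c d ∈ H := by
    have := D.pairs a b c d h1 h2 h3 h4 h5 h6; tauto
  have p2 : swap a c * swap b d ∈ H := by
    have := D.pairs a c b d h2 h1 h3 h4.symm h6 h5; tauto
  have p3 : swap a d * swap b c ∈ H := by
    have := D.pairs a d b c h3 h1 h2 h5.symm h6.symm h4; tauto
  refine D.disj (D.hh _ p1 _ p2) ?_
  convert p3 using 1
  ext i
  simp only [mul_inv_rev, Perm.mul_apply, swap_inv, swap_apply_def]
  grind

theorem three (D : CosetData G H) {a b c d : Fin n} (h1 : a ≠ b) (h2 : a ≠ c) (h3 : a ≠ d)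
    (h4 : b ≠ c) (h5 : b ≠ d) (h6 : c ≠ d) (e1 : swap a b ∈ H) (e2 : swap a c ∉ H)
    (e3 : swap a d ∉ H) (e4 : swap b c ∉ H) (e5 : swap b d ∉ H) (e6 : swap c d ∉ H) : False := by
  have p2 : swap a c * swap b d ∈ H := by
    have := D.pairs a c b d h2 h1 h3 h4.symm h6 h5; tauto
  have p3 : swap a d * swap b c ∈ H := by
    have := D.pairs a d b c h3 h1 h2 h5.symm h6.symm h4; tauto
  apply e6
  have := D.gh _ (D.hh _ p2 _ p3) _ e1
  convert this using 1
  ext i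
  simp only [mul_inv_rev, Perm.mul_apply, swap_inv, swap_apply_def]
  grind

theorem five (D : CosetData G H) {a b c d e : Fin n} (h1 : a ≠ b) (h2 : a ≠ c) (h3 : a ≠ d)
    (h4 : b ≠ c) (h5 : b ≠ d) (h6 : c ≠ d) (ha : e ≠ a) (hb : e ≠ b) (hc : e ≠ c) (hd : e ≠ d)
    (e2 : swap a c ∉ H)
    (e5 : swap b d ∉ H) (e6 : swap e d ∉ H) (eb : swap b e ∈ H) : False := by
  have p2 : swap a c * swap b d ∈ H := by
    have := D.pairs a c b d h2 h1 h3 h4.symm h6 h5; tauto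
  have p3 : swap a c * swap e d ∈ H := by
    have := D.pairs a c e d h2 ha.symm h3 hc.symm h6 hd; tauto
  have := D.gh _ (D.hh _ p2 _ p3) _ eb
  have h' : swap a c * swap b d * (swap a c * swap e d)⁻¹ * swap b e = swap e d ∨
     swap a c * swap b d * (swap a c * swap e d)⁻¹ * swap b e = swap b d := by
    left
    ext i
    simp only [mul_inv_rev, Perm.mul_apply, swap_inv, swap_apply_def]
    grind
  rcases h' with h' | h' <;> rw [h'] at this <;> contradiction

theorem alt (D : CosetData G H) (C : Set (Fin n))
    (hC : ∀ a ∈ C, ∀ b ∈ C, a ≠ b → swap a b ∈ H) :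
    ∀ m : ℕ, ∀ f : Perm (Fin n), f.support.card ≤ m → (∀ i, i ∉ C → f i = i) →
      (sign f = 1 → f ∈ G) ∧ (sign f = -1 → f ∈ H) := by
  intro m
  induction m with
  | zero =>
    intro f hf _
    have : f = 1 := by simpa using hf
    subst this
    simp [G.one_mem]
  | succ m ih =>
    intro f hf hfC
    by_cases h1 : f = 1
    · subst h1
      simp [G.one_mem]
    · obtain ⟨a, ha⟩ : ∃ a, f a ≠ a := by
        by_contra! hcon
        exact h1 (Perm.ext hcon)
      obtain ⟨b, hb⟩ := f.surjective a
      have hab : a ≠ b := by rintro rfl; exact ha hb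
      have haC : a ∈ C := by by_contra hcon; exact ha (hfC a hcon)
      have hbC : b ∈ C := by by_contra hcon; exact hab (by rw [← hb, hfC b hcon])
      have hss : (f * swap a b).support ⊂ f.support := by
        refine Finset.ssubset_iff_subset_ne.2 ⟨?_, ?_⟩
        · intro i hi
          rw [mem_support] at *
          intro hfi
          apply hi
          simp only [Perm.mul_apply, swap_apply_def]
          grind
        · intro he
          have : a ∈ (f * swap a b).support := by rw [he]; simpa using ha
          rw [mem_support] at this
          simp [hb] at this
      have hlt := Finset.card_lt_card hss
      obtain ⟨i1, i2⟩ := ih (f * swap a b) (by omega) (by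
        intro i hi
        have : i ≠ a := by rintro rfl; exact hi haC
        have : i ≠ b := by rintro rfl; exact hi hbC
        rw [Perm.mul_apply, swap_apply_of_ne_of_ne ‹_› ‹_›, hfC i hi])
      have hsw := hC a haC b hbC hab
      have hsg : sign (f * swap a b) = - sign f := by simp [sign_swap hab]
      rw [hsg] at i1 i2
      constructor
      · intro hs
        have := D.hh _ (i2 (by rw [hs])) _ hsw
        simpa [mul_assoc] using this
      · intro hs
        have := D.gh _ (i1 (by rw [hs]; simp)) _ hsw
        simpa [mul_assoc] using this

theorem case_one (D : CosetData G H) (hn : 4 ≤ n) (h : ∀ a b, a ≠ b → swap a b ∈ H) :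
    G = alternatingGroup (Fin n) := by
  have key := fun f => D.alt Set.univ (fun a _ b _ => h a b) _ f le_rfl (by simp)
  ext f
  rw [mem_alternatingGroup]
  constructor
  · intro hf
    rcases Int.units_eq_one_or (sign f) with h1 | h1
    · exact h1
    · exact (D.disj hf ((key f).2 h1)).elim
  · exact (key f).1

theorem case_two (D : CosetData G H) (hn : 4 ≤ n) (i : Fin n)
    (h : ∀ a b, a ≠ i → b ≠ i → a ≠ b → swap a b ∈ H) (hi : ∀ a, a ≠ i → swap i a ∉ H) :
    G = alternatingGroup (Fin n) ⊓ MulAction.stabilizer (Perm (Fin n)) i := by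
  have key : ∀ f : Perm (Fin n), f i = i → _ := fun f hf => D.alt {a | a ≠ i}
    (fun a ha b hb => h a b ha hb) _ f le_rfl (by simpa using hf)
  ext f
  rw [Subgroup.mem_inf, mem_alternatingGroup, MulAction.mem_stabilizer_iff, Perm.smul_def]
  constructor
  · intro hf
    have hfi : f i = i := by
      by_contra hne
      obtain ⟨c, hc⟩ := f.surjective i
      have hci : c ≠ i := by rintro rfl; exact hne hc
      obtain ⟨d, hd⟩ : ∃ d, d ∉ ({i, c, c} : Finset (Fin n)) := by
        by_contra! hcon
        have h1 := Finset.card_le_card (fun x _ => hcon x : Finset.univ ⊆ _)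
        have h2 := Finset.card_le_three (a := i) (b := c) (c := c)
        rw [Finset.card_univ, Fintype.card_fin] at h1
        omega
      obtain ⟨e, he⟩ : ∃ e, e ∉ ({i, c, d} : Finset (Fin n)) := by
        by_contra! hcon
        have h1 := Finset.card_le_card (fun x _ => hcon x : Finset.univ ⊆ _)
        have h2 := Finset.card_le_three (a := i) (b := c) (c := d)
        simp at h1
        omega
      simp only [Finset.mem_insert, Finset.mem_singleton, not_or] at hd he
      -- (c d)(d e) in G, conjugate by f
      have g1 : swap c d * (swap d e)⁻¹ ∈ G := D.hh _ (h _ _ hci hd.1 (Ne.symm hd.2.1)) _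
        (h _ _ hd.1 he.1 (Ne.symm he.2.2))
      have g2 := G.mul_mem (G.mul_mem hf g1) (G.inv_mem hf)
      have g3 : f * (swap c d * (swap d e)⁻¹) * f⁻¹ = swap i (f d) * swap (f d) (f e) := by
        rw [swap_inv, ← mul_assoc, mul_swap_eq_swap_mul f c d, mul_assoc (swap _ _) f,
          mul_swap_eq_swap_mul f d e, hc, mul_assoc, mul_assoc, mul_inv_cancel, mul_one]
      rw [g3] at g2
      have fdi : f d ≠ i := by rw [← hc]; exact fun h => hd.2.1 (f.injective h)
      have fei : f e ≠ i := by rw [← hc]; exact fun h => he.2.1 (f.injective h)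
      have fde : f d ≠ f e := fun h => he.2.2 (f.injective h).symm
      have := D.gh _ g2 _ (h _ _ fdi fei fde)
      rw [mul_assoc, swap_mul_self, mul_one] at this
      exact hi _ fdi this
    refine ⟨?_, hfi⟩
    rcases Int.units_eq_one_or (sign f) with h1 | h1
    · exact h1
    · exact (D.disj hf ((key f hfi).2 h1)).elim
  · rintro ⟨h1, h2⟩
    exact (key f h2).1 h1

theorem case_four (D : CosetData G H) (hn : n = 4) {a b c d : Fin n}
    (h1 : a ≠ b) (h2 : a ≠ c) (h3 : a ≠ d)
    (h4 : b ≠ c) (h5 : b ≠ d) (h6 : c ≠ d) (e1 : swap a b ∈ H) (e6 : swap c d ∈ H)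
    (e2 : swap a c ∉ H) (e3 : swap a d ∉ H) (e4 : swap b c ∉ H) (e5 : swap b d ∉ H) :
    ∃ σ : Perm (Fin n), σ.IsCycle ∧ σ.support.card = 4 ∧ G = Subgroup.zpowers σ := by
  have hall : ∀ x, x = a ∨ x = b ∨ x = c ∨ x = d := by
    intro x
    subst hn
    by_contra! hcon
    have := Finset.card_le_univ ({x, a, b, c, d} : Finset (Fin 4))
    rw [Finset.card_insert_of_notMem (by simp; tauto), Finset.card_insert_of_notMem (by simp; tauto),
      Finset.card_insert_of_notMem (by simp; tauto), Finset.card_insert_of_notMem (by simp; tauto)]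
      at this
    simp at this
  have p2 : swap a c * swap b d ∈ H := by
    have := D.pairs a c b d h2 h1 h3 h4.symm h6 h5; tauto
  have p3 : swap a d * swap b c ∈ H := by
    have := D.pairs a d b c h3 h1 h2 h5.symm h6.symm h4; tauto
  have hnd : [a, c, b, d].Nodup := by simp; tauto
  have hcyc := List.isCycle_formPerm hnd (by simp)
  have hsupp := List.support_formPerm_of_nodup [a, c, b, d] hnd (by simp)
  have hs : List.formPerm [a, c, b, d] = swap a b * (swap a c * swap b d)⁻¹ := by
    ext i
    simp only [List.formPerm_cons_cons, List.formPerm_singleton, mul_inv_rev, Perm.mul_apply,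
      swap_inv, swap_apply_def, Perm.one_apply]
    grind
  have hsG : List.formPerm [a, c, b, d] ∈ G := by rw [hs]; exact D.hh _ e1 _ p2
  set s := List.formPerm [a, c, b, d] with hsdef
  have sa : s a = c := by rw [hs]; simp [swap_apply_def]; grind
  have sc : s c = b := by rw [hs]; simp [swap_apply_def]; grind
  have sb : s b = d := by rw [hs]; simp [swap_apply_def]; grind
  have sd : s d = a := by rw [hs]; simp [swap_apply_def]; grind
  refine ⟨s, hcyc, ?_, ?_⟩
  · rw [hsupp, List.toFinset_card_of_nodup hnd]; rfl
  · apply le_antisymm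
    · have fixa : ∀ g ∈ G, g a = a → g = 1 := by
        intro g hg ga
        have i1 : ∀ i j, g i = g j → i = j := fun i j h => g.injective h
        have gb := hall (g b)
        have gc := hall (g c)
        have gd := hall (g d)
        have hcases : g = 1 ∨ g * (swap a d * swap b c) = swap a d ∨
            g * (swap a c * swap b d) = swap a c ∨ g = swap c d ∨ g * swap c d = swap b c ∨
            g * swap c d = swap b d := by
          have hb : g b ≠ a := fun h => h1 (i1 _ _ (by rw [ga, h]))
          have hc : g c ≠ a := fun h => h2 (i1 _ _ (by rw [ga, h]))
          have hd : g d ≠ a := fun h => h3 (i1 _ _ (by rw [ga, h]))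
          have hbc : g b ≠ g c := fun h => h4 (i1 _ _ h)
          have hbd : g b ≠ g d := fun h => h5 (i1 _ _ h)
          have hcd : g c ≠ g d := fun h => h6 (i1 _ _ h)
          have ext' : ∀ u v : Perm (Fin n), u a = v a → u b = v b → u c = v c → u d = v d →
              u = v := by
            intro u v _ _ _ _
            ext i
            rcases hall i with rfl | rfl | rfl | rfl <;> simp [*]
          rcases gb with gb | gb | gb | gb
          · exact absurd gb hb
          · rcases gc with gc | gc | gc | gc
            · exact absurd gc hc
            · grind
            · left; apply ext' <;> simp <;> grind
            · right; right; right; left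
              apply ext' <;> simp [swap_apply_def] <;> grind
          · rcases gc with gc | gc | gc | gc
            · exact absurd gc hc
            · right; left
              apply ext' <;> simp [swap_apply_def] <;> grind
            · grind
            · right; right; right; right; left
              apply ext' <;> simp [swap_apply_def] <;> grind
          · rcases gc with gc | gc | gc | gc
            · exact absurd gc hc
            · right; right; right; right; right
              apply ext' <;> simp [swap_apply_def] <;> grind
            · right; right; left
              apply ext' <;> simp [swap_apply_def] <;> grind
            · grind
        rcases hcases with h | h | h | h | h | h
        · exact h
        · exact absurd (h ▸ D.gh _ hg _ p3) e3
        · exact absurd (h ▸ D.gh _ hg _ p2) e2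
        · exact (D.disj hg (h ▸ e6)).elim
        · exact absurd (h ▸ D.gh _ hg _ e6) e4
        · exact absurd (h ▸ D.gh _ hg _ e6) e5
      intro g hg
      obtain ⟨j, hj⟩ : ∃ j : ℕ, (s ^ j) (g a) = a := by
        rcases hall (g a) with h | h | h | h
        · exact ⟨0, by simpa using h⟩
        · exact ⟨2, by simp [pow_succ, h, sb, sd]⟩
        · exact ⟨3, by simp [pow_succ, h, sb, sd, sc]⟩
        · exact ⟨1, by simp [h, sd]⟩
      have := fixa (s ^ j * g) (G.mul_mem (G.pow_mem hsG j) hg) (by simpa using hj)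
      rw [Subgroup.mem_zpowers_iff]
      refine ⟨-(j : ℤ), ?_⟩
      rw [zpow_neg, zpow_natCast]
      exact inv_eq_of_mul_eq_one_right this
    · rw [Subgroup.zpowers_le]; exact hsG

theorem main (D : CosetData G H) (hn : 4 ≤ n) :
    G = alternatingGroup (Fin n) ∨
      (∃ i : Fin n,
        G = alternatingGroup (Fin n) ⊓ MulAction.stabilizer (Equiv.Perm (Fin n)) i) ∨
      (n = 4 ∧ ∃ σ : Equiv.Perm (Fin n), σ.IsCycle ∧ σ.support.card = 4 ∧
        G = Subgroup.zpowers σ) := by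
  by_cases hall : ∀ a b, a ≠ b → swap a b ∈ H
  · exact Or.inl (D.case_one hn hall)
  right
  push Not at hall
  obtain ⟨p, q, hpq, hE⟩ := hall
  have tr : ∀ a b c, a ≠ c → swap a b ∈ H → swap b c ∈ H → swap a c ∈ H :=
    fun a b c h => D.trans h
  have sy : ∀ a b, swap a b ∈ H → swap b a ∈ H := fun a b h => by rwa [swap_comm]
  have cover : ∀ z, z ≠ p → z ≠ q → swap p z ∈ H ∨ swap q z ∈ H := by
    intro z hzp hzq
    by_contra! hcon
    obtain ⟨w, hw⟩ : ∃ w, w ∉ ({p, q, z} : Finset (Fin n)) := by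
      by_contra! hcon
      have h1 := Finset.card_le_card (fun x _ => hcon x : Finset.univ ⊆ _)
      have h2 := Finset.card_le_three (a := p) (b := q) (c := z)
      simp at h1
      omega
    simp only [Finset.mem_insert, Finset.mem_singleton, not_or] at hw
    obtain ⟨wp, wq, wz⟩ := hw
    obtain ⟨c1, c2⟩ := hcon
    by_cases f1 : swap p w ∈ H
    · refine D.three (a := p) (b := w) (c := q) (d := z) ?_ ?_ ?_ ?_ ?_ ?_ f1 ?_ ?_ ?_ ?_ ?_ <;> grind
    by_cases f2 : swap q w ∈ H
    · refine D.three (a := q) (b := w) (c := p) (d := z) ?_ ?_ ?_ ?_ ?_ ?_ f2 ?_ ?_ ?_ ?_ ?_ <;> grind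
    by_cases f3 : swap z w ∈ H
    · refine D.three (a := z) (b := w) (c := p) (d := q) ?_ ?_ ?_ ?_ ?_ ?_ f3 ?_ ?_ ?_ ?_ ?_ <;> grind
    refine D.four (a := p) (b := q) (c := z) (d := w) ?_ ?_ ?_ ?_ ?_ ?_ ?_ ?_ ?_ ?_ ?_ ?_ <;> grind
  by_cases hp : ∀ a, a ≠ p → swap p a ∉ H
  · left
    refine ⟨p, D.case_two hn p ?_ hp⟩
    intro a b ha hb hab
    have ca := cover a ha
    have cb := cover b hb
    grind
  by_cases hq : ∀ a, a ≠ q → swap q a ∉ H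
  · left
    refine ⟨q, D.case_two hn q ?_ hq⟩
    intro a b ha hb hab
    have ca := fun h => cover a h ha
    have cb := fun h => cover b h hb
    grind
  right
  push Not at hp hq
  obtain ⟨b, hbp, hb⟩ := hp
  obtain ⟨d, hdq, hd⟩ := hq
  have hbq : b ≠ q := by rintro rfl; exact hE hb
  have hdp : d ≠ p := by rintro rfl; exact hE (sy _ _ hd)
  have hbd : b ≠ d := by rintro rfl; exact hE (tr p b q hpq hb (sy _ _ hd))
  have e3 : swap p d ∉ H := by grind
  have e4 : swap b q ∉ H := by grind
  have e5 : swap b d ∉ H := by grind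
  have hn4 : n = 4 := by
    by_contra hne
    obtain ⟨e, he⟩ : ∃ w, w ∉ ({p, b, q, d} : Finset (Fin n)) := by
      by_contra! hcon
      have h1 := Finset.card_le_card (fun x _ => hcon x : Finset.univ ⊆ _)
      have h2 := Finset.card_le_four (a := p) (b := b) (c := q) (d := d)
      simp at h1
      omega
    simp only [Finset.mem_insert, Finset.mem_singleton, not_or] at he
    obtain ⟨ep, eb, eq, ed⟩ := he
    rcases cover e ep eq with h | h
    · refine D.five (a := p) (b := b) (c := q) (d := d) (e := e) ?_ ?_ ?_ ?_ ?_ ?_ ?_ ?_ ?_ ?_ ?_ ?_ ?_ ?_ <;> grind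
    · refine D.five (a := q) (b := d) (c := p) (d := b) (e := e) ?_ ?_ ?_ ?_ ?_ ?_ ?_ ?_ ?_ ?_ ?_ ?_ ?_ ?_ <;> grind
  exact ⟨hn4, D.case_four hn4 (a := p) (b := b) (c := q) (d := d) hbp.symm hpq hdp.symm hbq hbd
    hdq.symm hb hd hE e3 e4 e5⟩

end CosetData

theorem c4_aux : ∀ σ : Perm (Fin 4), σ ^ 4 = 1 → σ ^ 2 ≠ 1 →
    (∀ j : Fin 4, swap 0 ((σ ^ 2) 0) ≠ σ ^ (j : ℕ)) ∧
    ∀ x : Fin 4 → Fin 2, ∃ j : Fin 4, ∀ i, x (swap 0 ((σ ^ 2) 0) i) = x ((σ ^ (j : ℕ)) i) := by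
  decide +kernel

theorem c4_not_closed (σ : Perm (Fin 4)) (hc : σ.IsCycle) (hs : σ.support.card = 4) :
    ¬ IsGaloisClosed 2 (Subgroup.zpowers σ) := by
  have ho : orderOf σ = 4 := by rw [hc.orderOf, hs]
  have h4 : σ ^ 4 = 1 := by have := pow_orderOf_eq_one σ; rwa [ho] at this
  have h2 : σ ^ 2 ≠ 1 := by
    intro h
    have := orderOf_dvd_of_pow_eq_one h
    rw [ho] at this
    omega
  obtain ⟨a1, a2⟩ := c4_aux σ h4 h2
  refine not_closed_of (swap 0 ((σ ^ 2) 0)) ?_ ?_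
  · intro hm
    rw [mem_zpowers_iff_mem_range_orderOf, ho] at hm
    simp only [Finset.mem_image, Finset.mem_range] at hm
    obtain ⟨j, hj, he⟩ := hm
    exact a1 ⟨j, hj⟩ he.symm
  · intro x
    obtain ⟨j, hj⟩ := a2 x
    exact ⟨σ ^ (j : ℕ), Subgroup.npow_mem_zpowers σ j, hj⟩

theorem stmt_17 (n : ℕ) (hn : 4 ≤ n) (G : Subgroup (Equiv.Perm (Fin n))) :
    ¬ IsGaloisClosed (n - 2) G ↔
      G = alternatingGroup (Fin n) ∨
      (∃ i : Fin n,
        G = alternatingGroup (Fin n) ⊓ MulAction.stabilizer (Equiv.Perm (Fin n)) i) ∨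
      (n = 4 ∧ ∃ σ : Equiv.Perm (Fin n), σ.IsCycle ∧ σ.support.card = 4 ∧
        G = Subgroup.zpowers σ) := by
  constructor
  · intro h
    obtain ⟨H, D⟩ := exists_data hn h
    exact D.main hn
  · have coll : ∀ (i : Fin n) (x : Fin n → Fin (n-2)), ∃ a b, a ≠ i ∧ b ≠ i ∧ a ≠ b ∧ x a = x b := by
      intro i x
      have hlt : (Finset.univ : Finset (Fin (n-2))).card < (Finset.univ.erase i).card := by
        simp; omega
      obtain ⟨a, ha, b, hb, hab, he⟩ := Finset.exists_ne_map_eq_of_card_lt_of_maps_to hlt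
        (f := x) (by intro _ _; simp)
      exact ⟨a, b, by simpa using ha, by simpa using hb, hab, he⟩
    have hsw : ∀ (x : Fin n → Fin (n-2)) (a b : Fin n), x a = x b → ∀ j, x j = x (swap a b j) := by
      intro x a b h j
      rw [swap_apply_def]
      split_ifs with h1 h2
      · rw [h1, h]
      · rw [h2, h]
      · rfl
    rintro (rfl | ⟨i, rfl⟩ | ⟨rfl, σ, hc, hs, rfl⟩)
    · obtain ⟨u, v, -, -, huv, -⟩ := coll ⟨0, by omega⟩ (fun _ => ⟨0, by omega⟩)
      refine not_closed_of (swap u v) (by simp [mem_alternatingGroup, sign_swap huv]) ?_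
      intro x
      obtain ⟨a, b, -, -, hab, he⟩ := coll ⟨0, by omega⟩ x
      exact ⟨swap a b * swap u v, by simp [mem_alternatingGroup, sign_swap huv, sign_swap hab],
        fun j => hsw x a b he _⟩
    · obtain ⟨u, v, hu, hv, huv, -⟩ := coll i (fun _ => ⟨0, by omega⟩)
      refine not_closed_of (swap u v) (by simp [mem_alternatingGroup, sign_swap huv]) ?_
      intro x
      obtain ⟨a, b, ha, hb, hab, he⟩ := coll i x
      refine ⟨swap a b * swap u v, ?_, fun j => hsw x a b he _⟩
      rw [Subgroup.mem_inf, mem_alternatingGroup, MulAction.mem_stabilizer_iff, Perm.smul_def]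
      refine ⟨by simp [sign_swap huv, sign_swap hab], ?_⟩
      rw [Perm.mul_apply, swap_apply_of_ne_of_ne hu.symm hv.symm,
        swap_apply_of_ne_of_ne ha.symm hb.symm]
    · exact c4_not_closed σ hc hs
end
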